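/- arXiv:1009.5538 — 4 statements merged into one kernel-verified Lean document; each statement's English description precedes it below -/
import Mathlib

section
/- There exists an absolute constant c > 0 such that for every finite sequence X = x_1, …, x_m over any set with decidable equality, and every pair of complementary subsequences Y and Z that partition X, one has Σ_{i=1}^{|X|} lg(w_X(i)+2) ≤ c·(Σ_{i=1}^{|Y|} lg(w_Y(i)+2) + Σ_{i=1}^{|Z|} lg(w_Z(i)+2)). That is, interleaving two sequences can only increase the total working-set bound by an absolute constant factor. -/
/-- The working-set window of position `i` in the sequence `x`: indices `j < i`
such that no occurrence of `x i` lies in `[j, i)`, i.e. indices strictly between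
the previous occurrence `ω_X(i)` of `x i` (if any) and `i`. -/
def wsWindow {α : Type*} [DecidableEq α] {m : ℕ} (x : Fin m → α) (i : Fin m) :
    Finset (Fin m) :=
  Finset.univ.filter (fun j => j < i ∧ ∀ k : Fin m, j ≤ k → k < i → x k ≠ x i)

/-- The working-set number `w_X(i)`: number of distinct values in the window. -/
def wsNum {α : Type*} [DecidableEq α] {m : ℕ} (x : Fin m → α) (i : Fin m) : ℕ :=
  ((wsWindow x i).image x).card

/-- The working-set bound `Σ_i lg (w_X(i) + 2)`. -/
noncomputable def wsBound {α : Type*} [DecidableEq α] {m : ℕ} (x : Fin m → α) : ℝ :=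
  ∑ i : Fin m, Real.logb 2 ((wsNum x i : ℝ) + 2)

/-- `W_X(i)`: indices in the working-set window of `i` that are first
occurrences of their value within the window. -/
def wsSet {α : Type*} [DecidableEq α] {m : ℕ} (x : Fin m → α) (i : Fin m) :
    Finset (Fin m) :=
  (wsWindow x i).filter (fun j => ∀ j' ∈ wsWindow x i, j' < j → x j' ≠ x j)

/-- If `f j` is at least the rank of `j` in `S`, then `∑ 1 / (f j + 2)²` telescopes. -/
theorem sum_inv_sq_le_of_rank_le {ι : Type*} [LinearOrder ι] (S : Finset ι) (f : ι → ℕ)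
    (hf : ∀ j ∈ S, (S.filter (· < j)).card ≤ f j) :
    ∑ j ∈ S, 1 / ((f j : ℝ) + 2) ^ 2 ≤ 1 - 1 / ((S.card : ℝ) + 1) := by
  induction S using Finset.induction_on_max with
  | empty => simp
  | insert a s ha ih =>
    have has : a ∉ s := fun h => lt_irrefl a (ha a h)
    have hs := ih fun j hj =>
      (Finset.card_le_card (Finset.filter_subset_filter _ (Finset.subset_insert a s))).trans
        (hf j (Finset.mem_insert_of_mem hj))
    have hcard : s.card ≤ f a := by
      refine (Finset.card_le_card fun i hi => ?_).trans (hf a (Finset.mem_insert_self a s))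
      exact Finset.mem_filter.2 ⟨Finset.mem_insert_of_mem hi, ha i hi⟩
    have hcard' : (s.card : ℝ) ≤ f a := by exact_mod_cast hcard
    rw [Finset.sum_insert has, Finset.card_insert_of_notMem has]
    push_cast
    have hn : (0 : ℝ) ≤ s.card := Nat.cast_nonneg _
    set n : ℝ := (s.card : ℝ)
    have h1 : 1 / ((f a : ℝ) + 2) ^ 2 ≤ 1 / ((n + 1) * (n + 2)) :=
      one_div_le_one_div_of_le (by positivity) (by nlinarith)
    have h2 : 1 / ((n + 1) * (n + 2)) = 1 / (n + 1) - 1 / (n + 1 + 1) := by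
      field_simp
      ring
    linarith

/-- Among the windows of `x` at positions `mY j` that contain `t`, the `r`-th one belongs to an
access with working-set number at least `r` in the subsequence. -/
theorem card_lt_le_wsNum {α : Type*} [DecidableEq α] {m p : ℕ} (x : Fin m → α)
    (mY : Fin p → Fin m) (hY : StrictMono mY) (t : Fin m) (j : Fin p)
    (hj : t ∈ wsWindow x (mY j)) :
    (((Finset.univ.filter fun i => t ∈ wsWindow x (mY i)).filter (· < j)).card) ≤
      wsNum (x ∘ mY) j := by
  simp only [wsWindow, Finset.mem_filter, Finset.mem_univ, true_and] at hj
  have hinj : Set.InjOn (x ∘ mY)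
      ((Finset.univ.filter fun i => t ∈ wsWindow x (mY i)).filter (· < j)) := by
    intro a ha b hb hab
    simp only [wsWindow, Finset.coe_filter, Finset.mem_filter, Finset.mem_univ, true_and,
      Set.mem_ofPred_eq] at ha hb
    rcases lt_trichotomy a b with h | h | h
    · exact absurd hab (hb.1.2 _ ha.1.1.le (hY h))
    · exact h
    · exact absurd hab.symm (ha.1.2 _ hb.1.1.le (hY h))
  rw [← Finset.card_image_of_injOn hinj]
  refine Finset.card_le_card (Finset.image_subset_image fun i hi => ?_)
  simp only [wsWindow, Finset.mem_filter, Finset.mem_univ, true_and] at hi ⊢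
  exact ⟨hi.2, fun k hik hkj => hj.2 _ (hi.1.1.le.trans (hY.monotone hik)) (hY hkj)⟩

theorem wsNum_le_wsNum_add_card {α : Type*} [DecidableEq α] {m p q : ℕ} (x : Fin m → α)
    (mY : Fin p → Fin m) (mZ : Fin q → Fin m) (hY : StrictMono mY)
    (hcover : ∀ i : Fin m, (∃ j, mY j = i) ∨ (∃ k, mZ k = i)) (j : Fin p) :
    wsNum x (mY j) ≤ wsNum (x ∘ mY) j +
      (Finset.univ.filter fun k => mZ k ∈ wsWindow x (mY j)).card := by
  have hsub : (wsWindow x (mY j)).image x ⊆ (wsWindow (x ∘ mY) j).image (x ∘ mY) ∪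
      (Finset.univ.filter fun k => mZ k ∈ wsWindow x (mY j)).image (x ∘ mZ) := by
    intro a ha
    obtain ⟨t, ht, rfl⟩ := Finset.mem_image.1 ha
    rcases hcover t with ⟨i, rfl⟩ | ⟨k, rfl⟩
    · refine Finset.mem_union_left _ (Finset.mem_image.2 ⟨i, ?_, rfl⟩)
      simp only [wsWindow, Finset.mem_filter, Finset.mem_univ, true_and] at ht ⊢
      exact ⟨hY.lt_iff_lt.1 ht.1, fun k hik hkj => ht.2 _ (hY.monotone hik) (hY hkj)⟩
    · exact Finset.mem_union_right _ (Finset.mem_image.2 ⟨k, by simpa using ht, rfl⟩)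
  exact (Finset.card_le_card hsub).trans
    ((Finset.card_union_le _ _).trans (Nat.add_le_add_left Finset.card_image_le _))

theorem logb_two_add_le {K N : ℝ} (hK : 1 ≤ K) (hN : 0 ≤ N) :
    Real.logb 2 (K + N) ≤ 2 * Real.logb 2 K + 2 * (N * (1 / K ^ 2)) := by
  have hK0 : 0 < K := by linarith
  have hl2 : (1 : ℝ) / 2 < Real.log 2 := by linarith [Real.log_two_gt_d9]
  have h : Real.log (K + N) ≤ 2 * Real.log K + N * (1 / K ^ 2) := by
    calc Real.log (K + N) ≤ Real.log (K ^ 2 * (1 + N * (1 / K ^ 2))) := by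
          apply Real.log_le_log (by positivity)
          have : K ^ 2 * (1 + N * (1 / K ^ 2)) = K ^ 2 + N := by field_simp
          nlinarith
      _ = 2 * Real.log K + Real.log (1 + N * (1 / K ^ 2)) := by
          rw [Real.log_mul (by positivity) (by positivity), Real.log_pow]
          norm_num
      _ ≤ 2 * Real.log K + N * (1 / K ^ 2) := by
          linarith [Real.log_le_sub_one_of_pos (show 0 < 1 + N * (1 / K ^ 2) by positivity)]
  have hT : 0 ≤ N * (1 / K ^ 2) := by positivity
  simp only [Real.logb]
  rw [div_le_iff₀ (by linarith)]
  have : (2 * (Real.log K / Real.log 2) + 2 * (N * (1 / K ^ 2))) * Real.log 2 =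
      2 * Real.log K + 2 * Real.log 2 * (N * (1 / K ^ 2)) := by
    field_simp
  rw [this]
  nlinarith

theorem natCast_le_wsBound {α : Type*} [DecidableEq α] {m : ℕ} (x : Fin m → α) :
    (m : ℝ) ≤ wsBound x := by
  have h : ∑ _i : Fin m, (1 : ℝ) ≤ wsBound x := by
    refine Finset.sum_le_sum fun i _ => ?_
    rw [Real.le_logb_iff_rpow_le (by norm_num) (by positivity), Real.rpow_one]
    linarith [Nat.cast_nonneg (α := ℝ) (wsNum x i)]
  simpa using h

/-- The accesses of one subsequence contribute to the working-set bound of the merged sequence at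
most twice its own bound plus twice the length of the other subsequence. -/
theorem sum_logb_wsNum_le {α : Type*} [DecidableEq α] {m p q : ℕ} (x : Fin m → α)
    (mY : Fin p → Fin m) (mZ : Fin q → Fin m) (hY : StrictMono mY)
    (hcover : ∀ i : Fin m, (∃ j, mY j = i) ∨ (∃ k, mZ k = i)) :
    ∑ j, Real.logb 2 ((wsNum x (mY j) : ℝ) + 2) ≤ 2 * wsBound (x ∘ mY) + 2 * q := by
  set g : Fin p → ℝ := fun j => 1 / ((wsNum (x ∘ mY) j : ℝ) + 2) ^ 2
  have hterm (j : Fin p) : Real.logb 2 ((wsNum x (mY j) : ℝ) + 2) ≤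
      2 * Real.logb 2 ((wsNum (x ∘ mY) j : ℝ) + 2) +
        2 * ∑ k, if mZ k ∈ wsWindow x (mY j) then g j else 0 := by
    have hle : (wsNum x (mY j) : ℝ) ≤ wsNum (x ∘ mY) j +
        (Finset.univ.filter fun k => mZ k ∈ wsWindow x (mY j)).card := by
      exact_mod_cast wsNum_le_wsNum_add_card x mY mZ hY hcover j
    rw [← Finset.sum_filter, Finset.sum_const, nsmul_eq_mul]
    refine le_trans (Real.logb_le_logb_of_le (by norm_num) (by positivity) ?_)
      (logb_two_add_le (by linarith [Nat.cast_nonneg (α := ℝ) (wsNum (x ∘ mY) j)])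
        (Nat.cast_nonneg _))
    linarith
  have hcharge : ∑ j, ∑ k, (if mZ k ∈ wsWindow x (mY j) then g j else 0) ≤ (q : ℝ) := by
    rw [Finset.sum_comm]
    calc _ ≤ ∑ _k : Fin q, (1 : ℝ) := by
          refine Finset.sum_le_sum fun k _ => ?_
          rw [← Finset.sum_filter]
          refine (sum_inv_sq_le_of_rank_le _ (wsNum (x ∘ mY)) fun j hj =>
            card_lt_le_wsNum x mY hY (mZ k) j (Finset.mem_filter.1 hj).2).trans ?_
          exact sub_le_self _ (by positivity)
      _ = q := by simp
  calc _ ≤ _ := Finset.sum_le_sum fun j _ => hterm j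
    _ = 2 * wsBound (x ∘ mY) +
        2 * ∑ j, ∑ k, (if mZ k ∈ wsWindow x (mY j) then g j else 0) := by
      rw [Finset.sum_add_distrib, ← Finset.mul_sum, ← Finset.mul_sum, wsBound]
    _ ≤ _ := by linarith

/-- Interleaving two sequences increases the total working-set bound by at most
an absolute constant factor. -/
theorem workingSet_merge_upper :
    ∃ c : ℝ, 0 < c ∧
      ∀ (α : Type*) [DecidableEq α] (m p q : ℕ)
        (x : Fin m → α) (y : Fin p → α) (z : Fin q → α)
        (mY : Fin p → Fin m) (mZ : Fin q → Fin m),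
        StrictMono mY → StrictMono mZ →
        (∀ j k, mY j ≠ mZ k) →
        (∀ i : Fin m, (∃ j, mY j = i) ∨ (∃ k, mZ k = i)) →
        (∀ j, y j = x (mY j)) →
        (∀ k, z k = x (mZ k)) →
        wsBound x ≤ c * (wsBound y + wsBound z) := by
  refine ⟨4, by norm_num, fun α _ m p q x y z mY mZ hY hZ hdisj hcover hy hz => ?_⟩
  obtain rfl : y = x ∘ mY := funext hy
  obtain rfl : z = x ∘ mZ := funext hz
  have hbij : Function.Bijective (Sum.elim mY mZ) :=
    ⟨hY.injective.sumElim hZ.injective hdisj, fun i => by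
      rcases hcover i with ⟨j, h⟩ | ⟨k, h⟩
      · exact ⟨Sum.inl j, h⟩
      · exact ⟨Sum.inr k, h⟩⟩
  have hsplit : wsBound x = ∑ j, Real.logb 2 ((wsNum x (mY j) : ℝ) + 2) +
      ∑ k, Real.logb 2 ((wsNum x (mZ k) : ℝ) + 2) := by
    rw [wsBound, ← hbij.sum_comp, Fintype.sum_sum_type]
    rfl
  linarith [sum_logb_wsNum_le x mY mZ hY hcover,
    sum_logb_wsNum_le x mZ mY hZ fun i => (hcover i).symm,
    natCast_le_wsBound (x ∘ mY), natCast_le_wsBound (x ∘ mZ)]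
end

section
/- Let X = x_1, …, x_m be a finite sequence over a set with decidable equality, let 1 ≤ i ≤ m, and let W_X(i) be the set of indices j in the working-set window of position i such that x_j is the first occurrence of its value within that window. Let W'_X(i) consist of the ⌊w_X(i)/2⌋ largest indices of W_X(i). Then every index j ∈ W'_X(i) satisfies w_X(j) ≥ w_X(i)/2. -/
theorem mem_wsWindow_of_le {α : Type*} [DecidableEq α] {m : ℕ} {x : Fin m → α} {i j k : Fin m}
    (hj : j ∈ wsWindow x i) (hjk : j ≤ k) (hki : k < i) : k ∈ wsWindow x i := by
  simp only [wsWindow, Finset.mem_filter, Finset.mem_univ, true_and] at hj ⊢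
  exact ⟨hki, fun l hkl => hj.2 l (hjk.trans hkl)⟩

theorem lt_of_mem_wsWindow {α : Type*} [DecidableEq α] {m : ℕ} {x : Fin m → α} {i j : Fin m}
    (hj : j ∈ wsWindow x i) : j < i :=
  (Finset.mem_filter.1 hj).2.1

theorem injOn_wsSet {α : Type*} [DecidableEq α] {m : ℕ} (x : Fin m → α) (i : Fin m) :
    Set.InjOn x (wsSet x i) := by
  intro a ha b hb hab
  obtain ⟨haw, ha⟩ := Finset.mem_filter.1 ha
  obtain ⟨hbw, hb⟩ := Finset.mem_filter.1 hb
  rcases lt_trichotomy a b with h | h | h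
  · exact absurd hab (hb a haw h)
  · exact h
  · exact absurd hab.symm (ha b hbw h)

theorem image_wsSet {α : Type*} [DecidableEq α] {m : ℕ} (x : Fin m → α) (i : Fin m) :
    (wsSet x i).image x = (wsWindow x i).image x := by
  refine (Finset.image_subset_image (Finset.filter_subset _ _)).antisymm fun v hv => ?_
  obtain ⟨k, hk, rfl⟩ := Finset.mem_image.1 hv
  obtain ⟨a, ha, hmin⟩ := ((wsWindow x i).filter (x · = x k)).exists_min_image id
    ⟨k, Finset.mem_filter.2 ⟨hk, rfl⟩⟩
  obtain ⟨haw, hak⟩ := Finset.mem_filter.1 ha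
  refine Finset.mem_image.2 ⟨a, Finset.mem_filter.2 ⟨haw, fun b hb hba hxb => ?_⟩, hak⟩
  exact (hmin b (Finset.mem_filter.2 ⟨hb, hxb.trans hak⟩)).not_gt hba

theorem card_wsSet {α : Type*} [DecidableEq α] {m : ℕ} (x : Fin m → α) (i : Fin m) :
    (wsSet x i).card = wsNum x i := by
  rw [wsNum, ← image_wsSet, Finset.card_image_of_injOn (injOn_wsSet x i)]

theorem mem_wsWindow_of_lt_of_mem_wsSet {α : Type*} [DecidableEq α] {m : ℕ} {x : Fin m → α}
    {i j k : Fin m} (hj : j ∈ wsSet x i) (hk : k ∈ wsWindow x i) (hkj : k < j) :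
    k ∈ wsWindow x j := by
  obtain ⟨hjw, hj⟩ := Finset.mem_filter.1 hj
  exact Finset.mem_filter.2 ⟨Finset.mem_univ _, hkj, fun l hkl hlj =>
    hj l (mem_wsWindow_of_le hk hkl (hlj.trans (lt_of_mem_wsWindow hjw))) hlj⟩

theorem card_filter_lt_wsSet_le_wsNum {α : Type*} [DecidableEq α] {m : ℕ} {x : Fin m → α}
    {i j : Fin m} (hj : j ∈ wsSet x i) :
    ((wsSet x i).filter (fun k => ¬ j ≤ k)).card ≤ wsNum x j := by
  rw [← Finset.card_image_of_injOn
    ((injOn_wsSet x i).mono (Finset.coe_subset.2 (Finset.filter_subset _ _)))]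
  refine Finset.card_le_card (Finset.image_subset_image fun k hk => ?_)
  obtain ⟨hk, hkj⟩ := Finset.mem_filter.1 hk
  exact mem_wsWindow_of_lt_of_mem_wsSet hj (Finset.mem_filter.1 hk).1 (not_le.1 hkj)

/-- Every index `j` among the `⌊w_X(i)/2⌋` largest indices of `W_X(i)` (i.e.
whose rank from the top, `|{j' ∈ W_X(i) | j ≤ j'}|`, is at most `⌊w_X(i)/2⌋`)
satisfies `w_X(j) ≥ w_X(i)/2`. -/
theorem wsSet_top_half_large
    {α : Type*} [DecidableEq α] {m : ℕ} (x : Fin m → α) (i : Fin m) :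
    ∀ j ∈ wsSet x i,
      ((wsSet x i).filter (fun j' => j ≤ j')).card ≤ wsNum x i / 2 →
      (wsNum x i : ℝ) / 2 ≤ (wsNum x j : ℝ) := by
  intro j hj hrank
  have hlow := card_filter_lt_wsSet_le_wsNum hj
  have hsum := Finset.card_filter_add_card_filter_not (s := wsSet x i) (fun k => j ≤ k)
  rw [card_wsSet] at hsum
  have h : wsNum x i ≤ 2 * wsNum x j := by omega
  have h' : (wsNum x i : ℝ) ≤ 2 * wsNum x j := by exact_mod_cast h
  linarith
end

section
/- There exists an absolute constant c > 0 such that for every finite sequence X = x_1, …, x_m of integers and every integer f, Σ_{i=1}^m lg(w_X(i)+2) ≤ c·Σ_{i=1}^m lg min{|x_i − f|+2, m/q(x_i)+1, w_X(i)+2}, where q(a) is the number of indices i with x_i = a. That is, the working-set bound is at most an absolute constant times the unified bound. -/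
/-- `q(a)`: the number of indices `i` with `x i = a`. -/
def freq {α : Type*} [DecidableEq α] {m : ℕ} (x : Fin m → α) (a : α) : ℕ :=
  (Finset.univ.filter (fun i => x i = a)).card

/-- The unified bound `Σ_i lg min{|x_i − f| + 2, m/q(x_i) + 1, w_X(i) + 2}`
for integer sequences with respect to the finger `f`. -/
noncomputable def unifiedBound {m : ℕ} (x : Fin m → ℤ) (f : ℤ) : ℝ :=
  ∑ i : Fin m, Real.logb 2
    (min (min (((x i - f).natAbs : ℝ) + 2)
              ((m : ℝ) / (freq x (x i) : ℝ) + 1))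
         ((wsNum x i : ℝ) + 2))

/-- The windows of the positions holding a fixed value are disjoint, so their sizes sum to at
most the length of the sequence. -/
lemma sum_wsNum_le {α : Type*} [DecidableEq α] {m : ℕ} (x : Fin m → α) (a : α) :
    ∑ i ∈ Finset.univ.filter (fun i => x i = a), wsNum x i ≤ m := by
  have hdisj : ∀ i k j : Fin m, x i = a → x k = a → i < k →
      j ∈ wsWindow x i → j ∉ wsWindow x k := by
    intro i k j hi hk hik hji hjk
    simp only [wsWindow, Finset.mem_filter, Finset.mem_univ, true_and] at hji hjk
    exact hjk.2 i hji.1.le hik (hi.trans hk.symm)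
  calc ∑ i ∈ Finset.univ.filter (fun i => x i = a), wsNum x i
      ≤ ∑ i ∈ Finset.univ.filter (fun i => x i = a), (wsWindow x i).card :=
        Finset.sum_le_sum fun i _ => Finset.card_image_le
    _ = ((Finset.univ.filter (fun i => x i = a)).biUnion (wsWindow x)).card := by
        refine (Finset.card_biUnion ?_).symm
        intro i hi k hk hne
        simp only [Finset.coe_filter, Finset.mem_univ, true_and,
          Set.mem_ofPred_eq] at hi hk
        refine Finset.disjoint_left.mpr fun j hji hjk => ?_
        rcases lt_or_gt_of_ne hne with h | h
        · exact hdisj i k j hi hk h hji hjk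
        · exact hdisj k i j hk hi h hjk hji
    _ ≤ m := by
        simpa using Finset.card_le_univ
          ((Finset.univ.filter (fun i => x i = a)).biUnion (wsWindow x))

lemma freq_le {α : Type*} [DecidableEq α] {m : ℕ} (x : Fin m → α) (a : α) : freq x a ≤ m := by
  simpa [freq] using Finset.card_le_univ (Finset.univ.filter (fun i => x i = a))

lemma freq_pos {α : Type*} [DecidableEq α] {m : ℕ} (x : Fin m → α) (i : Fin m) :
    0 < freq x (x i) :=
  Finset.card_pos.mpr ⟨i, by simp⟩

/-- A weighted sum of working-set numbers, with weights depending only on the accessed value, is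
at most linear in the length of the sequence times the total weight. -/
lemma sum_wsNum_mul_le {α : Type*} [DecidableEq α] {m : ℕ} (x : Fin m → α) (g : α → ℝ)
    (hg : ∀ a, 0 ≤ g a) :
    ∑ i, ((wsNum x i : ℝ) + 2) * g (x i) ≤ 3 * m * ∑ a ∈ Finset.univ.image x, g a := by
  rw [← Finset.sum_fiberwise_of_maps_to (s := Finset.univ) (t := Finset.univ.image x) (g := x)
    (fun i hi => Finset.mem_image_of_mem x hi), Finset.mul_sum]
  refine Finset.sum_le_sum fun a _ => ?_
  have hfiber : ∑ i ∈ Finset.univ.filter (fun i => x i = a), ((wsNum x i : ℝ) + 2) ≤ 3 * m := by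
    have h1 : (∑ i ∈ Finset.univ.filter (fun i => x i = a), (wsNum x i : ℝ)) ≤ m := by
      exact_mod_cast sum_wsNum_le x a
    have h2 : ((Finset.univ.filter (fun i => x i = a)).card : ℝ) ≤ m := by
      exact_mod_cast freq_le x a
    rw [Finset.sum_add_distrib, Finset.sum_const, nsmul_eq_mul]
    linarith
  calc ∑ i ∈ Finset.univ.filter (fun i => x i = a), ((wsNum x i : ℝ) + 2) * g (x i)
      = (∑ i ∈ Finset.univ.filter (fun i => x i = a), ((wsNum x i : ℝ) + 2)) * g a := by
        rw [Finset.sum_mul]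
        refine Finset.sum_congr rfl fun i hi => ?_
        rw [(Finset.mem_filter.mp hi).2]
    _ ≤ 3 * m * g a := mul_le_mul_of_nonneg_right hfiber (hg a)

lemma sum_freq_image {α : Type*} [DecidableEq α] {m : ℕ} (x : Fin m → α) :
    ∑ a ∈ Finset.univ.image x, freq x a = m := by
  simpa [freq] using (Finset.card_eq_sum_card_image x Finset.univ).symm

lemma logb_two_le_two_mul_div_add {W r : ℝ} (hW : 0 < W) (hr : 0 < r) :
    Real.logb 2 W ≤ 2 * (W / r) + Real.logb 2 r := by
  have hpos : 0 < W / r := div_pos hW hr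
  have h : Real.logb 2 (W / r) ≤ 2 * (W / r) := by
    rw [Real.logb, div_le_iff₀ (Real.log_pos one_lt_two)]
    nlinarith [Real.log_le_sub_one_of_pos hpos, Real.log_two_gt_d9]
  rw [Real.logb_div hW.ne' hr.ne'] at h
  linarith

lemma summable_int_inv_natAbs_add_two_sq :
    Summable (fun k : ℤ => (((k.natAbs : ℝ) + 2) ^ 2)⁻¹) := by
  have h : Summable (fun n : ℕ => (((n : ℝ) + 2) ^ 2)⁻¹) := by
    have := (summable_nat_add_iff 2).mpr (Real.summable_nat_pow_inv.mpr one_lt_two)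
    simpa using this
  exact Summable.of_nat_of_neg (by simpa using h) (by simpa using h)

lemma sum_inv_natAbs_sub_add_two_sq_le (s : Finset ℤ) (f : ℤ) :
    ∑ a ∈ s, ((((a - f).natAbs : ℝ) + 2) ^ 2)⁻¹ ≤
      ∑' k : ℤ, (((k.natAbs : ℝ) + 2) ^ 2)⁻¹ := by
  rw [← Finset.sum_image (s := s) (g := fun a => a - f)
    (f := fun k : ℤ => (((k.natAbs : ℝ) + 2) ^ 2)⁻¹) (fun a _ b _ h => sub_left_injective h)]
  exact summable_int_inv_natAbs_add_two_sq.sum_le_tsum _ fun k _ => by positivity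

lemma two_le_min_unified {m : ℕ} (x : Fin m → ℤ) (f : ℤ) (i : Fin m) :
    (2 : ℝ) ≤ min (min (((x i - f).natAbs : ℝ) + 2) ((m : ℝ) / (freq x (x i) : ℝ) + 1))
      ((wsNum x i : ℝ) + 2) := by
  have hq : (0 : ℝ) < freq x (x i) := by exact_mod_cast freq_pos x i
  have hqm : (freq x (x i) : ℝ) ≤ m := by exact_mod_cast freq_le x (x i)
  have h : (1 : ℝ) ≤ (m : ℝ) / freq x (x i) := (one_le_div hq).mpr hqm
  refine le_min (le_min ?_ ?_) ?_
  · simp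
  · linarith
  · simp

lemma length_le_unifiedBound {m : ℕ} (x : Fin m → ℤ) (f : ℤ) : (m : ℝ) ≤ unifiedBound x f := by
  have h : ∑ _i : Fin m, (1 : ℝ) ≤ unifiedBound x f := by
    refine Finset.sum_le_sum fun i _ => ?_
    refine (Real.logb_self_eq_one one_lt_two).symm.le.trans ?_
    exact Real.logb_le_logb_of_le one_lt_two two_pos (two_le_min_unified x f i)
  simpa using h

/-- Termwise, the working-set cost exceeds twice the unified cost by at most a weighted
working-set number, the weights being inverse square rank distance and relative frequency. -/
lemma logb_wsNum_le {m : ℕ} (x : Fin m → ℤ) (f : ℤ) (i : Fin m) :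
    Real.logb 2 ((wsNum x i : ℝ) + 2) ≤
      2 * (((wsNum x i : ℝ) + 2) *
        (((((x i - f).natAbs : ℝ) + 2) ^ 2)⁻¹ + (freq x (x i) : ℝ) / m)) +
      2 * Real.logb 2
        (min (min (((x i - f).natAbs : ℝ) + 2) ((m : ℝ) / (freq x (x i) : ℝ) + 1))
          ((wsNum x i : ℝ) + 2)) := by
  have hq : (0 : ℝ) < freq x (x i) := by exact_mod_cast freq_pos x i
  have hm : (0 : ℝ) < m := hq.trans_le (by exact_mod_cast freq_le x (x i))
  have hmin := two_le_min_unified x f i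
  set W : ℝ := (wsNum x i : ℝ) + 2 with hWdef
  set d : ℝ := ((x i - f).natAbs : ℝ) + 2 with hddef
  set q : ℝ := (freq x (x i) : ℝ)
  have hW : 0 < W := by positivity
  have hd : 0 < d := by positivity
  have hd0 : 0 ≤ W * (d ^ 2)⁻¹ := by positivity
  have hq0 : 0 ≤ W * (q / m) := by positivity
  rw [mul_add W]
  rcases min_choice (min d ((m : ℝ) / q + 1)) W with h | h
  · rcases min_choice d ((m : ℝ) / q + 1) with h' | h'
    · rw [h, h']
      have key := logb_two_le_two_mul_div_add hW (pow_pos hd 2)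
      rw [Real.logb_pow, div_eq_mul_inv] at key
      push_cast at key
      linarith
    · rw [h, h'] at hmin ⊢
      have key := logb_two_le_two_mul_div_add hW (div_pos hm hq)
      have hle : Real.logb 2 ((m : ℝ) / q) ≤ Real.logb 2 ((m : ℝ) / q + 1) :=
        Real.logb_le_logb_of_le one_lt_two (div_pos hm hq) (by linarith)
      have hnn : 0 ≤ Real.logb 2 ((m : ℝ) / q + 1) :=
        Real.logb_nonneg one_lt_two (by linarith)
      rw [div_eq_mul_inv W, inv_div] at key
      linarith
  · rw [h] at hmin ⊢
    have hnn : 0 ≤ Real.logb 2 W := Real.logb_nonneg one_lt_two (by linarith)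
    linarith

/-- The working-set bound is at most an absolute constant times the unified
bound. -/
theorem workingSet_le_unified :
    ∃ c : ℝ, 0 < c ∧
      ∀ (m : ℕ) (x : Fin m → ℤ) (f : ℤ),
        wsBound x ≤ c * unifiedBound x f := by
  set S : ℝ := ∑' k : ℤ, (((k.natAbs : ℝ) + 2) ^ 2)⁻¹ with hS
  have hS0 : 0 ≤ S := tsum_nonneg fun k => by positivity
  refine ⟨6 * (S + 1) + 2, by positivity, fun m x f => ?_⟩
  have hweight : ∑ a ∈ Finset.univ.image x,
      (((((a - f).natAbs : ℝ) + 2) ^ 2)⁻¹ + (freq x a : ℝ) / m) ≤ S + 1 := by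
    rw [Finset.sum_add_distrib, ← Finset.sum_div]
    refine add_le_add (sum_inv_natAbs_sub_add_two_sq_le _ f) ?_
    rw [← Nat.cast_sum, sum_freq_image]
    exact div_self_le_one _
  have hsum := sum_wsNum_mul_le x
    (fun a => ((((a - f).natAbs : ℝ) + 2) ^ 2)⁻¹ + (freq x a : ℝ) / m)
    (fun a => by positivity)
  have hterm : wsBound x ≤ 2 * ∑ i, ((wsNum x i : ℝ) + 2) *
        (((((x i - f).natAbs : ℝ) + 2) ^ 2)⁻¹ + (freq x (x i) : ℝ) / m) +
      2 * unifiedBound x f := by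
    rw [wsBound, unifiedBound, Finset.mul_sum, Finset.mul_sum, ← Finset.sum_add_distrib]
    exact Finset.sum_le_sum fun i _ => logb_wsNum_le x f i
  have h1 := mul_le_mul_of_nonneg_left hweight (by positivity : (0 : ℝ) ≤ 3 * m)
  have h2 := mul_le_mul_of_nonneg_right (length_le_unifiedBound x f)
    (by positivity : 0 ≤ S + 1)
  linarith
end

section
/- The static-finger bound dominates the working-set bound: there exists an absolute constant c > 0 such that for every finite sequence X = x_1, …, x_m of integers and every integer f (the finger), Σ_{i=1}^m lg(w_X(i)+2) ≤ c·Σ_{i=1}^m lg(|x_i − f|+2). -/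
theorem wsNum_le_card_wsWindow {α : Type*} [DecidableEq α] {m : ℕ} (x : Fin m → α) (i : Fin m) :
    wsNum x i ≤ (wsWindow x i).card :=
  Finset.card_image_le

/-- An index lies in at most one working-set window for each value of the sequence. -/
theorem injOn_setOf_mem_wsWindow {α : Type*} [DecidableEq α] {m : ℕ} (x : Fin m → α)
    (j : Fin m) : Set.InjOn x {i | j ∈ wsWindow x i} := by
  intro a ha b hb hab
  simp only [Set.mem_ofPred_eq, wsWindow, Finset.mem_filter, Finset.mem_univ, true_and] at ha hb
  rcases lt_trichotomy a b with h | h | h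
  · exact absurd hab (hb.2 a ha.1.le h)
  · exact h
  · exact absurd hab.symm (ha.2 b hb.1.le h)

theorem summable_inv_natAbs_add_two_sq :
    Summable fun z : ℤ => (((z.natAbs : ℝ) + 2) ^ 2)⁻¹ := by
  have h : Summable fun n : ℕ => (((n : ℝ) + 2) ^ 2)⁻¹ := by
    have h := (summable_nat_add_iff 2).mpr (Real.summable_nat_pow_inv.mpr one_lt_two)
    simpa using h
  refine Summable.of_nat_of_neg ?_ ?_ <;> simpa using h

/-- Double counting: the window sizes, weighted by the inverse square of the distance to the
finger, sum to at most a constant times the length of the sequence. -/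
theorem sum_wsNum_mul_le_s11 {m : ℕ} (x : Fin m → ℤ) (f : ℤ) :
    ∑ i, (wsNum x i : ℝ) * ((((x i - f).natAbs : ℝ) + 2) ^ 2)⁻¹ ≤
      m * ∑' z : ℤ, (((z.natAbs : ℝ) + 2) ^ 2)⁻¹ := by
  set g : ℤ → ℝ := fun z => (((z.natAbs : ℝ) + 2) ^ 2)⁻¹ with hg
  have hg0 : ∀ z, 0 ≤ g z := fun z => by positivity
  calc ∑ i, (wsNum x i : ℝ) * g (x i - f)
      ≤ ∑ i, ∑ j, if j ∈ wsWindow x i then g (x i - f) else 0 := by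
        refine Finset.sum_le_sum fun i _ => ?_
        rw [Finset.sum_ite_mem, Finset.univ_inter, Finset.sum_const, nsmul_eq_mul]
        exact mul_le_mul_of_nonneg_right (by exact_mod_cast wsNum_le_card_wsWindow x i) (hg0 _)
    _ = ∑ j, ∑ i, if j ∈ wsWindow x i then g (x i - f) else 0 := Finset.sum_comm
    _ ≤ ∑ _j : Fin m, ∑' z, g z := by
        refine Finset.sum_le_sum fun j _ => ?_
        rw [← Finset.sum_filter]
        have hinj : Set.InjOn (fun i => x i - f)
            (Finset.univ.filter fun i => j ∈ wsWindow x i : Finset (Fin m)) := by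
          intro a ha b hb hab
          exact injOn_setOf_mem_wsWindow x j (by simpa using ha) (by simpa using hb)
            (by simpa using hab)
        rw [← Finset.sum_image (f := g) hinj]
        exact summable_inv_natAbs_add_two_sq.sum_le_tsum _ fun z _ => hg0 z
    _ = m * ∑' z, g z := by simp

theorem logb_add_two_le {w d : ℝ} (hw : 0 ≤ w) (hd : 0 ≤ d) :
    Real.logb 2 (w + 2) ≤ 2 * Real.logb 2 (d + 2) + w * ((d + 2) ^ 2)⁻¹ / Real.log 2 := by
  have hlog : 0 < Real.log 2 := Real.log_pos one_lt_two
  have hA : 0 < (d + 2) ^ 2 := by positivity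
  have h := Real.log_le_sub_one_of_pos (x := (w + 2) / (d + 2) ^ 2) (by positivity)
  rw [Real.log_div (by positivity) hA.ne', Real.log_pow, add_div] at h
  have h2 : 2 / (d + 2) ^ 2 ≤ 1 := by
    rw [div_le_one hA]
    nlinarith
  have h3 : Real.log (w + 2) ≤ 2 * Real.log (d + 2) + w * ((d + 2) ^ 2)⁻¹ := by
    rw [← div_eq_mul_inv]
    push_cast at h
    linarith
  calc Real.logb 2 (w + 2) = Real.log (w + 2) / Real.log 2 := rfl
    _ ≤ (2 * Real.log (d + 2) + w * ((d + 2) ^ 2)⁻¹) / Real.log 2 := by gcongr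
    _ = _ := by rw [Real.logb]; ring

/-- The static-finger bound dominates the working-set bound. -/
theorem workingSet_le_staticFinger :
    ∃ c : ℝ, 0 < c ∧
      ∀ (m : ℕ) (x : Fin m → ℤ) (f : ℤ),
        wsBound x ≤
          c * ∑ i : Fin m,
                Real.logb 2 (((x i - f).natAbs : ℝ) + 2) := by
  set C : ℝ := ∑' z : ℤ, (((z.natAbs : ℝ) + 2) ^ 2)⁻¹
  have hC : 0 ≤ C := tsum_nonneg fun z => by positivity
  have hlog : 0 < Real.log 2 := Real.log_pos one_lt_two
  refine ⟨2 + C / Real.log 2, by positivity, fun m x f => ?_⟩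
  have hm : (m : ℝ) ≤ ∑ i : Fin m, Real.logb 2 (((x i - f).natAbs : ℝ) + 2) := by
    calc (m : ℝ) = ∑ _i : Fin m, (1 : ℝ) := by simp
      _ ≤ _ := Finset.sum_le_sum fun i _ => by
        rw [Real.le_logb_iff_rpow_le one_lt_two (by positivity), Real.rpow_one]
        exact le_add_of_nonneg_left (Nat.cast_nonneg _)
  calc wsBound x
      ≤ ∑ i, (2 * Real.logb 2 (((x i - f).natAbs : ℝ) + 2) +
          (wsNum x i : ℝ) * ((((x i - f).natAbs : ℝ) + 2) ^ 2)⁻¹ / Real.log 2) :=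
        Finset.sum_le_sum fun i _ => logb_add_two_le (Nat.cast_nonneg _) (Nat.cast_nonneg _)
    _ = 2 * ∑ i, Real.logb 2 (((x i - f).natAbs : ℝ) + 2) +
          (∑ i, (wsNum x i : ℝ) * ((((x i - f).natAbs : ℝ) + 2) ^ 2)⁻¹) / Real.log 2 := by
        rw [Finset.sum_add_distrib, Finset.mul_sum, Finset.sum_div]
    _ ≤ 2 * ∑ i, Real.logb 2 (((x i - f).natAbs : ℝ) + 2) + m * C / Real.log 2 := by
        gcongr
        exact sum_wsNum_mul_le_s11 x f
    _ ≤ 2 * ∑ i, Real.logb 2 (((x i - f).natAbs : ℝ) + 2) +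
          (∑ i, Real.logb 2 (((x i - f).natAbs : ℝ) + 2)) * C / Real.log 2 := by
        gcongr
    _ = _ := by ring
end
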